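/- arXiv:1910.13050 — 3 statements merged into one kernel-verified Lean document; each statement's English description precedes it below -/
import Mathlib

section
/- For every vector y ∈ ℝ³ and all indices l, k, if ⟪y, x_l⟫ < ⟪y, x_k⟫ (strict inequality), then f_l(y) > f_k(y) (strict inequality); in particular, any index maximizing the response f_·(y) must minimize the projection ⟪y, x_·⟫ over the point cloud. -/
open scoped RealInnerProductSpace

/-- The spherical response of the point cloud `x` at the point `x i`, evaluated in the
viewing direction `y`: `f_i(y) = Σ_j max (0, ⟪y, x j - x i⟫)`. -/
noncomputable def sphericalResponse {N : ℕ} (x : Fin N → EuclideanSpace ℝ (Fin 3))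
    (i : Fin N) (y : EuclideanSpace ℝ (Fin 3)) : ℝ :=
  ∑ j, max 0 ⟪y, x j - x i⟫

/-- For a fixed viewing direction `y`, the spherical response is strictly antitone in the
projection of the base point onto `y`; in particular any index maximizing the response
must minimize the projection `⟪y, x ·⟫` over the point cloud. -/
theorem sphericalResponse_strictAnti {N : ℕ} (x : Fin N → EuclideanSpace ℝ (Fin 3))
    (y : EuclideanSpace ℝ (Fin 3)) :
    (∀ l k : Fin N, ⟪y, x l⟫ < ⟪y, x k⟫ → sphericalResponse x k y < sphericalResponse x l y) ∧
      (∀ m : Fin N, (∀ j, sphericalResponse x j y ≤ sphericalResponse x m y) →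
        ∀ j, ⟪y, x m⟫ ≤ ⟪y, x j⟫) := by
  have key : ∀ l k : Fin N, ⟪y, x l⟫ < ⟪y, x k⟫ →
      sphericalResponse x k y < sphericalResponse x l y := by
    intro l k h
    unfold sphericalResponse
    apply Finset.sum_lt_sum
    · intro j _
      simp only [inner_sub_right]
      exact max_le_max le_rfl (by linarith)
    · refine ⟨k, Finset.mem_univ k, ?_⟩
      simp only [inner_sub_right, sub_self, inner_zero_right, max_self]
      exact lt_max_of_lt_right (by linarith)
  refine ⟨key, fun m hm j => ?_⟩
  by_contra hlt
  exact absurd (key j m (not_le.mp hlt)) (not_lt.mpr (hm j))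
end

section
/- (Points with largest responses lie on the convex hull.) Let y ∈ ℝ³ be a nonzero vector and suppose the point x_k lies in the interior of the convex hull of the point cloud, i.e. x_k ∈ interior (convexHull ℝ (Set.range x)). Then there exists an index l with f_l(y) > f_k(y); consequently no index whose point lies in the interior of the convex hull can attain the maximum of the response f_·(y), so every maximizer of the response lies on the boundary (frontier) of the convex hull of the point cloud. -/
open scoped RealInnerProductSpace

theorem exists_larger_response {N : ℕ}
    (x : Fin N → EuclideanSpace ℝ (Fin 3)) (y : EuclideanSpace ℝ (Fin 3)) (hy : y ≠ 0)
    (k : Fin N) (hk : x k ∈ interior (convexHull ℝ (Set.range x))) :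
    ∃ l, sphericalResponse x k y < sphericalResponse x l y := by
  have key : ∃ l, ⟪y, x l⟫ < ⟪y, x k⟫ := by
    by_contra! h
    have hsub : convexHull ℝ (Set.range x) ⊆ {z | ⟪y, x k⟫ ≤ ⟪y, z⟫} := by
      apply convexHull_min
      · rintro _ ⟨j, rfl⟩
        exact h j
      · exact convex_halfSpace_ge (innerSL ℝ y).isLinear _
    have hc : Filter.Tendsto (fun t : ℝ => x k - t • y) (nhdsWithin 0 (Set.Ioi 0)) (nhds (x k)) := by
      have : Continuous (fun t : ℝ => x k - t • y) := by fun_prop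
      have h2 := this.tendsto 0
      simp only [zero_smul, sub_zero] at h2
      exact h2.mono_left nhdsWithin_le_nhds
    have h1 := hc.eventually (mem_interior_iff_mem_nhds.1 hk)
    obtain ⟨t, ht, ht0⟩ := (h1.and self_mem_nhdsWithin).exists
    have h3 : ⟪y, x k⟫ ≤ ⟪y, x k - t • y⟫ := hsub ht
    rw [inner_sub_right, inner_smul_right] at h3
    have h4 : 0 < ⟪y, y⟫ := real_inner_self_pos.2 hy
    have h5 : 0 < t * ⟪y, y⟫ := mul_pos ht0 h4
    linarith
  obtain ⟨l, hl⟩ := key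
  refine ⟨l, ?_⟩
  unfold sphericalResponse
  apply Finset.sum_lt_sum
  · intro j _
    apply max_le_max le_rfl
    rw [inner_sub_right, inner_sub_right]
    linarith
  · refine ⟨k, Finset.mem_univ k, ?_⟩
    rw [sub_self, inner_zero_right, max_self]
    apply lt_max_of_lt_right
    rw [inner_sub_right]
    linarith

/-- Points with the largest spherical responses lie on the convex hull: if `y ≠ 0` and
`x k` lies in the interior of the convex hull of the point cloud, then some index `l` has a
strictly larger response; consequently every index maximizing the response has its point on
the frontier (boundary) of the convex hull of the point cloud. -/
theorem sphericalResponse_max_mem_convexHull_frontier {N : ℕ}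
    (x : Fin N → EuclideanSpace ℝ (Fin 3)) (y : EuclideanSpace ℝ (Fin 3)) (hy : y ≠ 0)
    (k : Fin N) (hk : x k ∈ interior (convexHull ℝ (Set.range x))) :
    (∃ l, sphericalResponse x k y < sphericalResponse x l y) ∧
      ∀ m : Fin N, (∀ j, sphericalResponse x j y ≤ sphericalResponse x m y) →
        x m ∈ frontier (convexHull ℝ (Set.range x)) := by
  refine ⟨exists_larger_response x y hy k hk, fun m hm => ⟨?_, fun hi => ?_⟩⟩
  · exact subset_closure (subset_convexHull ℝ _ ⟨m, rfl⟩)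
  · obtain ⟨l, hl⟩ := exists_larger_response x y hy m hi
    exact absurd (hm l) (not_le.2 hl)
end

section
/- (SO(3)-equivariance of the S² correlation.) Let μ be a finite measure on the unit sphere S² = {v ∈ ℝ³ : ‖v‖ = 1} that is invariant under every linear isometry equivalence of ℝ³ (i.e., every rotation is measure preserving for μ). Let f, w : S² → ℝ be bounded measurable functions. For rotations g, R (linear isometry equivalences of ℝ³ mapping S² to itself), define (f ⋆ w)(g) = ∫_{S²} f(v) · w(g⁻¹ v) dμ(v). Then for every rotation R and every rotation g, ((R·f) ⋆ w)(g) = (f ⋆ w)(R⁻¹ ∘ g), where (R·f)(v) := f(R⁻¹ v). In other words, the spherical correlation is equivariant to the action of rotations on the signal. -/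
open MeasureTheory

/-- The unit sphere `S²` in `ℝ³`. -/
abbrev Sphere2 : Set (EuclideanSpace ℝ (Fin 3)) := Metric.sphere (0 : EuclideanSpace ℝ (Fin 3)) 1

/-- The action of a rotation (linear isometry equivalence of `ℝ³`) on the unit sphere. -/
noncomputable def rotSphere (R : EuclideanSpace ℝ (Fin 3) ≃ₗᵢ[ℝ] EuclideanSpace ℝ (Fin 3)) (v : Sphere2) :
    Sphere2 :=
  ⟨R v, by
    have hv := v.2
    simp only [mem_sphere_iff_norm, sub_zero] at hv ⊢
    rw [R.norm_map]
    exact hv⟩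

/-- SO(3)-equivariance of the `S²` correlation: for a rotation-invariant measure `μ` on the
unit sphere and bounded measurable signal `f` and kernel `w`, the spherical correlation
`(f ⋆ w)(g) = ∫ f(v) · w(g⁻¹ v) dμ(v)` satisfies `((R·f) ⋆ w)(g) = (f ⋆ w)(R⁻¹ ∘ g)`,
where `(R·f)(v) = f (R⁻¹ v)` and `R⁻¹ ∘ g` is the rotation `g.trans R.symm`. -/
theorem sphericalCorrelation_equivariant (μ : Measure Sphere2) [IsFiniteMeasure μ]
    (hμ : ∀ R : EuclideanSpace ℝ (Fin 3) ≃ₗᵢ[ℝ] EuclideanSpace ℝ (Fin 3),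
      MeasurePreserving (rotSphere R) μ μ)
    (f w : Sphere2 → ℝ) (hf : Measurable f) (hw : Measurable w)
    (Cf Cw : ℝ) (hfb : ∀ v, |f v| ≤ Cf) (hwb : ∀ v, |w v| ≤ Cw)
    (R g : EuclideanSpace ℝ (Fin 3) ≃ₗᵢ[ℝ] EuclideanSpace ℝ (Fin 3)) :
    ∫ v, f (rotSphere R.symm v) * w (rotSphere g.symm v) ∂μ =
      ∫ v, f v * w (rotSphere (g.trans R.symm).symm v) ∂μ := by
  have hm : Measurable fun v => f v * w (rotSphere (g.trans R.symm).symm v) :=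
    hf.mul (hw.comp (hμ _).measurable)
  have h := integral_map (hμ R.symm).measurable.aemeasurable
    (hm.aestronglyMeasurable (μ := Measure.map (rotSphere R.symm) μ))
  rw [(hμ R.symm).map_eq] at h
  rw [h]
  have key : ∀ v, rotSphere (g.trans R.symm).symm (rotSphere R.symm v) = rotSphere g.symm v := by
    intro v
    apply Subtype.ext
    simp [rotSphere]
  simp only [key]
end
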